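/- Let b̂ ∈ P(𝒜,𝒢) be an acyclic feasible point such that b̂_{ij} > 0 implies v_{ij} > 0, and let b* maximize f_cvx over { b ∈ P(𝒜,𝒢) : b_{ij} = 0 whenever b̂_{ij} = 0 }; write q*_j = Σ_{i∈𝒜} b*_{ij}. Let b ∈ P(𝒜,𝒢) satisfy b_{ij} = 0 whenever b*_{ij} = 0, and q_j = 1 for every item j with q*_j = 1. Then f_cvx(b*) − f_cvx(b) = Σ_{j∈𝒢} Σ_{i∈𝒜} w_i b_{ij} · log( (Σ_{i'∈𝒜} w_{i'} b_{i'j}) / (Σ_{i'∈𝒜} w_{i'} b*_{i'j}) ). -/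

import Mathlib

open Finset

/-- The feasibility polytope `P(𝒜,𝒢)`. -/
def Feasible {A G : Type*} [Fintype A] [Fintype G] (b : A → G → ℝ) : Prop :=
  (∀ i j, 0 ≤ b i j) ∧ (∀ i, ∑ j, b i j = 1) ∧ (∀ j, ∑ i, b i j ≤ 1)

/-- The support graph of `b`: bipartite graph on `𝒜 ⊕ 𝒢` with an edge `{i,j}` iff `b i j > 0`. -/
def supportGraph {A G : Type*} (b : A → G → ℝ) : SimpleGraph (A ⊕ G) :=
  SimpleGraph.fromRel (fun x y => ∃ i j, x = Sum.inl i ∧ y = Sum.inr j ∧ 0 < b i j)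

/-- The objective of the convex program CVX-Weighted. -/
noncomputable def fcvx {A G : Type*} [Fintype A] [Fintype G]
    (v : A → G → ℝ) (w : A → ℝ) (b : A → G → ℝ) : ℝ :=
  (∑ i, ∑ j, w i * b i j * Real.log (v i j))
    - ∑ j, (∑ i, w i * b i j) * Real.log (∑ i, w i * b i j)
    + ∑ i, w i * Real.log (w i)

/-- Near `t = 0` the line through `x` and `y` stays feasible, provided `y` is supported within the
support of `x` and saturates every column that `x` saturates. -/
theorem Feasible.eventually_line {A G : Type*} [Fintype A] [Fintype G] {x y : A → G → ℝ}
    (hx : Feasible x) (hy : Feasible y) (hsupp : ∀ i j, x i j = 0 → y i j = 0)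
    (hq : ∀ j, (∑ i, x i j) = 1 → (∑ i, y i j) = 1) :
    ∀ᶠ t : ℝ in nhds 0, Feasible fun i j => x i j + t * (y i j - x i j) := by
  have hnonneg : ∀ᶠ t : ℝ in nhds 0, ∀ i j, 0 ≤ x i j + t * (y i j - x i j) := by
    simp only [Filter.eventually_all]
    intro i j
    rcases (hx.1 i j).eq_or_lt with h | h
    · simp [← h, hsupp i j h.symm]
    · have hc : ContinuousAt (fun t : ℝ => x i j + t * (y i j - x i j)) 0 := by fun_prop
      exact (hc.eventually_const_lt (by simpa using h)).mono fun _ => le_of_lt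
  have hcol : ∀ᶠ t : ℝ in nhds 0, ∀ j, ∑ i, (x i j + t * (y i j - x i j)) ≤ 1 := by
    simp only [Filter.eventually_all, sum_add_distrib, ← mul_sum, sum_sub_distrib]
    intro j
    rcases (hx.2.2 j).eq_or_lt with h | h
    · simp [h, hq j h]
    · have hc : ContinuousAt
          (fun t : ℝ => ∑ i, x i j + t * (∑ i, y i j - ∑ i, x i j)) 0 := by fun_prop
      exact (hc.eventually_lt_const (by simpa using h)).mono fun _ => le_of_lt
  filter_upwards [hnonneg, hcol] with t h₁ h₂
  refine ⟨h₁, fun i => ?_, h₂⟩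
  simp [sum_add_distrib, ← mul_sum, hx.2.1 i, hy.2.1 i]

theorem hasDerivAt_mul_log_line {a c : ℝ} (h : a = 0 → c = 0) :
    HasDerivAt (fun t : ℝ => (a + t * (c - a)) * Real.log (a + t * (c - a)))
      ((Real.log a + 1) * (c - a)) 0 := by
  by_cases ha : a = 0
  · simpa [ha, h ha] using hasDerivAt_const (0 : ℝ) (0 : ℝ)
  · have hline : HasDerivAt (fun t : ℝ => a + t * (c - a)) (c - a) 0 := by
      simpa using ((hasDerivAt_id (0 : ℝ)).mul_const (c - a)).const_add a
    exact HasDerivAt.comp (h₂ := fun s => s * Real.log s) 0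
      (by simpa using Real.hasDerivAt_mul_log ha) hline

/-- The directional derivative of `fcvx` at `x` towards `y`. -/
theorem hasDerivAt_fcvx_line {A G : Type*} [Fintype A] [Fintype G] (v : A → G → ℝ) (w : A → ℝ)
    {x y : A → G → ℝ} (h : ∀ j, ∑ i, w i * x i j = 0 → ∑ i, w i * y i j = 0) :
    HasDerivAt (fun t : ℝ => fcvx v w fun i j => x i j + t * (y i j - x i j))
      ((∑ i, ∑ j, w i * (y i j - x i j) * Real.log (v i j))
        - ∑ j, (Real.log (∑ i, w i * x i j) + 1) * (∑ i, w i * y i j - ∑ i, w i * x i j)) 0 := by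
  have hcol : ∀ (t : ℝ) j, ∑ i, w i * (x i j + t * (y i j - x i j))
      = ∑ i, w i * x i j + t * (∑ i, w i * y i j - ∑ i, w i * x i j) := by
    intro t j
    rw [← sum_sub_distrib, mul_sum, ← sum_add_distrib]
    exact sum_congr rfl fun i _ => by ring
  simp only [fcvx, hcol]
  refine (HasDerivAt.sub (HasDerivAt.fun_sum fun i _ => HasDerivAt.fun_sum fun j _ => ?_)
    (HasDerivAt.fun_sum fun j _ => hasDerivAt_mul_log_line (h j))).add_const _
  have := ((((hasDerivAt_id (0 : ℝ)).mul_const (y i j - x i j)).const_add (x i j)).const_mul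
    (w i)).mul_const (Real.log (v i j))
  simpa using this

/-- Lemma `a-change`: Let `b*` maximize `f_cvx` over the feasible points
supported within the support of an acyclic feasible point `b̂` (whose support lies in the
support of `v`).  For any feasible `b` supported within the support of `b*` such that
`q_j = 1` whenever `q*_j = 1`, one has
`f_cvx(b*) − f_cvx(b) = Σ_j Σ_i w_i b_{ij} log((Σ_{i'} w_{i'} b_{i'j})/(Σ_{i'} w_{i'} b*_{i'j}))`. -/
theorem stability_of_restricted_optimum
    (A G : Type*) [Fintype A] [Fintype G]
    (v : A → G → ℝ) (w : A → ℝ)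
    (hv : ∀ i j, 0 ≤ v i j) (hw : ∀ i, 0 < w i) (hws : ∑ i, w i = 1)
    (bhat bstar b : A → G → ℝ)
    (hbhat : Feasible bhat)
    (hbhatacyc : (supportGraph bhat).IsAcyclic)
    (hbhatv : ∀ i j, 0 < bhat i j → 0 < v i j)
    (hbstar : Feasible bstar)
    (hbstarsupp : ∀ i j, bhat i j = 0 → bstar i j = 0)
    (hopt : ∀ b' : A → G → ℝ, Feasible b' → (∀ i j, bhat i j = 0 → b' i j = 0) →
      fcvx v w b' ≤ fcvx v w bstar)
    (hb : Feasible b)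
    (hbsupp : ∀ i j, bstar i j = 0 → b i j = 0)
    (hq : ∀ j, (∑ i, bstar i j) = 1 → (∑ i, b i j) = 1) :
    fcvx v w bstar - fcvx v w b
      = ∑ j, ∑ i, w i * b i j *
          Real.log ((∑ i', w i' * b i' j) / (∑ i', w i' * bstar i' j)) := by
  have hs0 : ∀ j, ∑ i, w i * bstar i j = 0 → ∑ i, w i * b i j = 0 := by
    intro j h
    rw [sum_eq_zero_iff_of_nonneg fun i _ => mul_nonneg (hw i).le (hbstar.1 i j)] at h
    refine sum_eq_zero fun i hi => ?_
    rw [hbsupp i j ((mul_eq_zero.1 (h i hi)).resolve_left (hw i).ne'), mul_zero]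
  have hmax : IsLocalMax (fun t : ℝ => fcvx v w fun i j => bstar i j + t * (b i j - bstar i j))
      0 := by
    filter_upwards [hbstar.eventually_line hb hbsupp hq] with t ht
    simp only [zero_mul, add_zero]
    refine hopt _ ht fun i j h => ?_
    have h' := hbstarsupp i j h
    simp [h', hbsupp i j h']
  have hstat := hmax.hasDerivAt_eq_zero (hasDerivAt_fcvx_line v w hs0)
  have htotal : ∀ x : A → G → ℝ, Feasible x → ∑ j, ∑ i, w i * x i j = 1 := by
    intro x hx
    rw [sum_comm]
    simp [← mul_sum, hx.2.1, hws]
  have hsum : ∑ j, (∑ i, w i * b i j - ∑ i, w i * bstar i j) = 0 := by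
    rw [sum_sub_distrib, htotal b hb, htotal bstar hbstar, sub_self]
  have hrhs : ∀ j, ∑ i, w i * b i j *
      Real.log ((∑ i', w i' * b i' j) / (∑ i', w i' * bstar i' j))
      = (∑ i, w i * b i j) * Real.log (∑ i, w i * b i j)
        - (∑ i, w i * b i j) * Real.log (∑ i, w i * bstar i j) := by
    intro j
    rw [← sum_mul]
    by_cases hbj : ∑ i, w i * b i j = 0
    · simp [hbj]
    · rw [Real.log_div hbj (mt (hs0 j) hbj), mul_sub]
  simp only [hrhs, fcvx]
  simp only [mul_sub, sub_mul, add_mul, one_mul, sum_sub_distrib, sum_add_distrib]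
    at hstat hsum ⊢
  simp only [mul_comm (Real.log (∑ i, w i * bstar i _))] at hstat
  linarith
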